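/- Suppose the BFGS initialization satisfies ‖x_0 − x_*‖ ≤ μ^{3/2}/(400·M·√L) and ‖Ĥ_0 − I‖_F ≤ 1/24. Then for every k ≥ 1 the BFGS iterates satisfy ‖x_k − x_*‖ ≤ √(L/μ)·(1/k)^{k/2}·‖x_0 − x_*‖. -/

import Mathlib

noncomputable section

open Matrix Finset

abbrev E (d : ℕ) := EuclideanSpace ℝ (Fin d)
abbrev Mat (d : ℕ) := Matrix (Fin d) (Fin d) ℝ

/-- Spectral (operator 2-) norm of a real matrix. -/
def spec {d : ℕ} (A : Mat d) : ℝ := ‖Matrix.toEuclideanCLM (𝕜 := ℝ) A‖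

/-- Frobenius norm of a real matrix. -/
def frob {d : ℕ} (A : Mat d) : ℝ := Real.sqrt (∑ i, ∑ j, (A i j) ^ 2)

/-- A matrix acting on a Euclidean vector. -/
def mApp {d : ℕ} (A : Mat d) (v : E d) : E d := Matrix.toEuclideanCLM (𝕜 := ℝ) A v

/-- Outer product `u vᵀ`. -/
def outer {d : ℕ} (u v : E d) : Mat d := Matrix.of fun i j => u i * v j

/-- Euclidean dot product. -/
def dot {d : ℕ} (u v : E d) : ℝ := ∑ i, u i * v i

/-- `σ(x) = (M/μ^{3/2})·‖H_*^{1/2}(x − x_*)‖`. -/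
def sig {d : ℕ} (M μ : ℝ) (sqH : Mat d) (xs x : E d) : ℝ :=
  M / μ ^ ((3:ℝ)/2) * ‖mApp sqH (x - xs)‖

/-- The BFGS update of the inverse Hessian approximation. -/
def bfgsUpdate {d : ℕ} (H : Mat d) (s y : E d) : Mat d :=
  (1 - (dot y s)⁻¹ • outer s y) * H * (1 - (dot s y)⁻¹ • outer y s)
    + (dot y s)⁻¹ • outer s s


section FrobeniusNorm

attribute [local instance] Matrix.frobeniusNormedAddCommGroup Matrix.frobeniusNormedSpace
  Matrix.frobeniusNormedRing

variable {d : ℕ}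

theorem frobenius_norm_sq (A : Mat d) : ‖A‖ ^ 2 = ∑ i, ∑ j, (A i j) ^ 2 := by
  rw [Matrix.frobenius_norm_def, ← Real.sqrt_eq_rpow, Real.sq_sqrt (by positivity)]
  simp

theorem frob_eq_norm (A : Mat d) : frob A = ‖A‖ := by
  rw [frob, ← frobenius_norm_sq, Real.sqrt_sq (norm_nonneg _)]

theorem mApp_apply (A : Mat d) (v : E d) (i : Fin d) : mApp A v i = ∑ j, A i j * v j := by
  simp [mApp, Matrix.mulVec, dotProduct]

theorem dot_eq_inner (u v : E d) : dot u v = inner ℝ u v := by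
  simp [dot, PiLp.inner_apply, mul_comm]

theorem mApp_mul (A B : Mat d) (v : E d) : mApp (A * B) v = mApp A (mApp B v) := by
  simp [mApp]

theorem mApp_one (v : E d) : mApp (1 : Mat d) v = v := by
  simp [mApp]

theorem mApp_sub (A : Mat d) (v w : E d) : mApp A (v - w) = mApp A v - mApp A w := by
  simp [mApp]

theorem mApp_add (A : Mat d) (v w : E d) : mApp A (v + w) = mApp A v + mApp A w := by
  simp [mApp]

theorem mApp_smul (A : Mat d) (c : ℝ) (v : E d) : mApp A (c • v) = c • mApp A v := by
  simp [mApp]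

theorem sub_mApp (A B : Mat d) (v : E d) : mApp (A - B) v = mApp A v - mApp B v := by
  simp [mApp]

theorem dot_mApp (A : Mat d) (u v : E d) : dot u (mApp A v) = dot (mApp Aᵀ u) v := by
  simp only [dot, mApp_apply, Matrix.transpose_apply, Finset.mul_sum, Finset.sum_mul]
  rw [Finset.sum_comm]
  exact Finset.sum_congr rfl fun i _ => Finset.sum_congr rfl fun j _ => by ring

theorem outer_transpose (u v : E d) : (outer u v)ᵀ = outer v u := by
  ext i j; simp [outer, mul_comm]

theorem outer_mApp (A B : Mat d) (u v : E d) :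
    outer (mApp A u) (mApp B v) = A * outer u v * Bᵀ := by
  ext i j
  simp only [outer, Matrix.of_apply, mApp_apply, Matrix.mul_apply, Matrix.transpose_apply,
    Finset.sum_mul, Finset.mul_sum]
  exact Finset.sum_congr rfl fun i _ => Finset.sum_congr rfl fun j _ => by ring

theorem outer_mul_outer (a b u v : E d) : outer a b * outer u v = dot b u • outer a v := by
  ext i j
  simp only [outer, Matrix.mul_apply, Matrix.of_apply, Matrix.smul_apply, dot, smul_eq_mul,
    Finset.sum_mul]
  exact Finset.sum_congr rfl fun k _ => by ring

theorem norm_outer (u v : E d) : ‖outer u v‖ = ‖u‖ * ‖v‖ := by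
  rw [← sq_eq_sq₀ (norm_nonneg _) (by positivity), frobenius_norm_sq, mul_pow,
    EuclideanSpace.real_norm_sq_eq, EuclideanSpace.real_norm_sq_eq, Finset.sum_mul_sum]
  simp [outer, mul_pow]

theorem dot_self (u : E d) : dot u u = ‖u‖ ^ 2 := by
  rw [dot_eq_inner, real_inner_self_eq_norm_sq]

theorem norm_sq_mul_one_sub_outer (A : Mat d) {u : E d} (hu : ‖u‖ = 1) :
    ‖A * (1 - outer u u)‖ ^ 2 = ‖A‖ ^ 2 - ‖mApp A u‖ ^ 2 := by
  have hentry : ∀ i j, (A * (1 - outer u u)) i j = A i j - mApp A u i * u j := fun i j => by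
    rw [mul_sub, mul_one, Matrix.sub_apply, Matrix.mul_apply, mApp_apply, Finset.sum_mul]
    simp [outer, mul_assoc]
  have hu' : ∑ j, u j ^ 2 = 1 := by rw [← EuclideanSpace.real_norm_sq_eq, hu, one_pow]
  rw [frobenius_norm_sq, frobenius_norm_sq, EuclideanSpace.real_norm_sq_eq,
    ← Finset.sum_sub_distrib]
  refine Finset.sum_congr rfl fun i _ => ?_
  have h1 : ∑ j, (A i j - mApp A u i * u j) ^ 2 = ∑ j, A i j ^ 2
      - 2 * mApp A u i * ∑ j, A i j * u j + mApp A u i ^ 2 * ∑ j, u j ^ 2 := by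
    rw [Finset.mul_sum, Finset.mul_sum, ← Finset.sum_sub_distrib, ← Finset.sum_add_distrib]
    exact Finset.sum_congr rfl fun j _ => by ring
  simp only [hentry, h1, hu', ← mApp_apply]
  ring

theorem norm_mul_one_sub_outer_le (A : Mat d) {u : E d} (hu : ‖u‖ = 1) :
    ‖A * (1 - outer u u)‖ ≤ ‖A‖ := by
  refine le_of_sq_le_sq ?_ (norm_nonneg _)
  rw [norm_sq_mul_one_sub_outer A hu]
  linarith [sq_nonneg ‖mApp A u‖]

theorem norm_one_sub_outer_mul_le (A : Mat d) {u : E d} (hu : ‖u‖ = 1) :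
    ‖(1 - outer u u) * A‖ ≤ ‖A‖ := by
  rw [← Matrix.frobenius_norm_transpose, ← Matrix.frobenius_norm_transpose A,
    Matrix.transpose_mul, Matrix.transpose_sub, Matrix.transpose_one, outer_transpose]
  exact norm_mul_one_sub_outer_le _ hu

theorem norm_mApp_le (A : Mat d) (v : E d) : ‖mApp A v‖ ≤ ‖A‖ * ‖v‖ := by
  rcases eq_or_ne v 0 with rfl | hv
  · simp [mApp]
  have hv' : 0 < ‖v‖ := norm_pos_iff.2 hv
  have hu : ‖‖v‖⁻¹ • v‖ = 1 := by rw [norm_smul, norm_inv, norm_norm, inv_mul_cancel₀ hv'.ne']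
  have h := norm_sq_mul_one_sub_outer A hu
  have h1 : ‖mApp A (‖v‖⁻¹ • v)‖ ≤ ‖A‖ :=
    le_of_sq_le_sq (by nlinarith [sq_nonneg ‖A * (1 - outer (‖v‖⁻¹ • v) (‖v‖⁻¹ • v))‖])
      (norm_nonneg _)
  rw [mApp_smul, norm_smul, norm_inv, norm_norm, inv_mul_le_iff₀ hv'] at h1
  linarith

theorem bfgsUpdate_smul (B : Mat d) (s y : E d) {c : ℝ} (hc : c ≠ 0) :
    bfgsUpdate B (c • s) (c • y) = bfgsUpdate B s y := by
  have hd : ∀ a b : E d, dot (c • a) (c • b) = c ^ 2 * dot a b := fun a b => by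
    simp only [dot_eq_inner, real_inner_smul_left, real_inner_smul_right]; ring
  have ho : ∀ a b : E d, outer (c • a) (c • b) = c ^ 2 • outer a b := fun a b => by
    ext i j; simp [outer]; ring
  have hcc : ∀ r : ℝ, (c ^ 2 * r)⁻¹ * c ^ 2 = r⁻¹ := fun r => by
    rw [mul_inv]; field_simp
  simp only [bfgsUpdate, hd, ho, smul_smul, hcc]

/-- One BFGS update along a unit direction does not increase the squared Frobenius distance to
the identity, up to an error linear in the deviation of `v` from the secant direction `u`. -/
theorem norm_sq_bfgsUpdate_sub_one_le (B : Mat d) {u v : E d} {τ : ℝ} (hu : ‖u‖ = 1)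
    (hv : ‖v - u‖ ≤ τ) (hτ : τ ≤ 1 / 400) (hB : ‖B - 1‖ ≤ 1 / 10) :
    ‖bfgsUpdate B u v - 1‖ ^ 2 ≤ ‖B - 1‖ ^ 2 - ‖mApp (B - 1) u‖ ^ 2 + τ := by
  have hτ0 : 0 ≤ τ := (norm_nonneg _).trans hv
  set A := B - 1 with hA
  set P : Mat d := 1 - outer u u with hP
  set a := dot v u with ha
  have hau : dot u v = a := by rw [ha, dot_eq_inner, dot_eq_inner, real_inner_comm]
  have ha1 : |a - 1| ≤ τ := by
    have h : a - 1 = inner ℝ (v - u) u := by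
      rw [inner_sub_left, real_inner_self_eq_norm_sq, hu, ha, dot_eq_inner]; norm_num
    rw [h]
    exact (abs_real_inner_le_norm _ _).trans (by rwa [hu, mul_one])
  obtain ⟨ha2, ha3⟩ := abs_le.1 ha1
  have ha0 : 0 < a := by linarith
  have hinv : a⁻¹ ≤ 400 / 399 := by
    rw [inv_le_comm₀ ha0 (by norm_num)]; norm_num; linarith
  have hinv1 : |a⁻¹ - 1| ≤ 400 / 399 * τ := by
    have h : a⁻¹ - 1 = a⁻¹ * (1 - a) := by field_simp
    rw [h, abs_mul, abs_of_pos (inv_pos.2 ha0), abs_sub_comm]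
    gcongr
  set Q : Mat d := outer u (u - a⁻¹ • v) with hQ
  have hQn : ‖Q‖ ≤ 400 / 399 * τ := by
    have h1 : u - a⁻¹ • v = a⁻¹ • (a • u - v) := by
      rw [smul_sub, smul_smul, inv_mul_cancel₀ ha0.ne', one_smul]
    have h2 : ‖a • u - v‖ ≤ τ := by
      refine (le_of_sq_le_sq ?_ (norm_nonneg _)).trans hv
      rw [norm_sub_sq_real, norm_sub_sq_real, norm_smul, real_inner_smul_left, hu,
        ← dot_eq_inner, ← dot_eq_inner, hau, ← ha, mul_pow, Real.norm_eq_abs, sq_abs]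
      nlinarith [sq_nonneg (a - 1)]
    rw [hQ, norm_outer, hu, one_mul, h1, norm_smul, norm_inv, Real.norm_eq_abs, abs_of_pos ha0]
    gcongr
  have hV : (1 : Mat d) - a⁻¹ • outer u v = P + Q := by
    ext i j; simp [P, Q, outer]; ring
  have hVt : (1 : Mat d) - a⁻¹ • outer v u = P + Qᵀ := by
    ext i j; simp [P, Q, outer]; ring
  have hPP : P * P = P := by
    rw [hP, mul_sub, sub_mul, sub_mul, outer_mul_outer, dot_self, hu]; simp
  have hdecomp : bfgsUpdate B u v - 1 = P * (A * P)
      + ((a⁻¹ - 1) • outer u u + Q * P + P * Qᵀ + Q * Qᵀ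
        + Q * (A * P) + (P * A) * Qᵀ + Q * A * Qᵀ) := by
    have hB' : B = A + 1 := by rw [hA]; abel
    have hPo : outer u u = 1 - P := by rw [hP]; abel
    rw [bfgsUpdate, hau, hV, hVt, hB', sub_smul, one_smul]
    nth_rewrite 3 [hPo]
    have : (P + Q) * (A + 1) * (P + Qᵀ) = P * (A * P) + P * P + Q * P + P * Qᵀ + Q * Qᵀ
        + Q * (A * P) + (P * A) * Qᵀ + Q * A * Qᵀ := by noncomm_ring
    rw [this, hPP]
    abel
  set θ := ‖mApp A u‖
  have hX : ‖P * (A * P)‖ ^ 2 ≤ ‖A‖ ^ 2 - θ ^ 2 := by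
    rw [← norm_sq_mul_one_sub_outer A hu]
    gcongr
    exact norm_one_sub_outer_mul_le _ hu
  have hQt : ‖Qᵀ‖ = ‖Q‖ := Matrix.frobenius_norm_transpose Q
  have hR : ‖(a⁻¹ - 1) • outer u u + Q * P + P * Qᵀ + Q * Qᵀ
        + Q * (A * P) + (P * A) * Qᵀ + Q * A * Qᵀ‖ ≤ 4 * τ := by
    have e1 : ‖(a⁻¹ - 1) • outer u u‖ ≤ 400 / 399 * τ := by
      rw [norm_smul, norm_outer, hu, Real.norm_eq_abs]; simpa using hinv1
    have e2 : ‖Q * P‖ ≤ 400 / 399 * τ := (norm_mul_one_sub_outer_le _ hu).trans hQn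
    have e3 : ‖P * Qᵀ‖ ≤ 400 / 399 * τ :=
      (norm_one_sub_outer_mul_le _ hu).trans (hQt.le.trans hQn)
    have e4 : ‖Q * Qᵀ‖ ≤ (400 / 399 * τ) * (400 / 399 * τ) :=
      (norm_mul_le _ _).trans (by rw [hQt]; gcongr)
    have e5 : ‖Q * (A * P)‖ ≤ (400 / 399 * τ) * (1 / 10) :=
      (norm_mul_le _ _).trans (by
        gcongr
        exact (norm_mul_one_sub_outer_le _ hu).trans hB)
    have e6 : ‖(P * A) * Qᵀ‖ ≤ (1 / 10) * (400 / 399 * τ) :=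
      (norm_mul_le _ _).trans (by
        rw [hQt]
        gcongr
        exact (norm_one_sub_outer_mul_le _ hu).trans hB)
    have e7 : ‖Q * A * Qᵀ‖ ≤ (400 / 399 * τ) * (1 / 10) * (400 / 399 * τ) :=
      (norm_mul_le _ _).trans (by
        rw [hQt]
        gcongr
        exact (norm_mul_le _ _).trans (by gcongr))
    refine (norm_add_le_of_le (norm_add_le_of_le (norm_add_le_of_le (norm_add_le_of_le
      (norm_add_le_of_le (norm_add_le_of_le e1 e2) e3) e4) e5) e6) e7).trans ?_
    nlinarith
  have hXA : ‖P * (A * P)‖ ≤ 1 / 10 :=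
    (norm_one_sub_outer_mul_le _ hu).trans ((norm_mul_one_sub_outer_le _ hu).trans hB)
  rw [hdecomp]
  have hs := norm_add_le_of_le le_rfl hR (a₁ := P * (A * P))
  have := pow_le_pow_left₀ (norm_nonneg _) hs 2
  nlinarith [norm_nonneg (P * (A * P))]

theorem norm_sq_bfgsUpdate_sub_one_le_of_ne_zero (B : Mat d) {s y : E d} {τ : ℝ} (hs : s ≠ 0)
    (hy : ‖y - s‖ ≤ τ * ‖s‖) (hτ : τ ≤ 1 / 400) (hB : ‖B - 1‖ ≤ 1 / 10) :
    ‖bfgsUpdate B s y - 1‖ ^ 2 ≤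
      ‖B - 1‖ ^ 2 - (‖mApp (B - 1) s‖ / ‖s‖) ^ 2 + τ := by
  have hs' : 0 < ‖s‖ := norm_pos_iff.2 hs
  rw [← bfgsUpdate_smul B s y (inv_ne_zero hs'.ne')]
  have hu : ‖‖s‖⁻¹ • s‖ = 1 := by rw [norm_smul, norm_inv, norm_norm, inv_mul_cancel₀ hs'.ne']
  have hv : ‖‖s‖⁻¹ • y - ‖s‖⁻¹ • s‖ ≤ τ := by
    rw [← smul_sub, norm_smul, norm_inv, norm_norm, inv_mul_le_iff₀ hs']
    linarith
  have h := norm_sq_bfgsUpdate_sub_one_le B hu hv hτ hB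
  rwa [mApp_smul, norm_smul, norm_inv, norm_norm, inv_mul_eq_div] at h

/-- One step of BFGS in the coordinates where the Hessian at the minimizer is the identity. -/
theorem bfgs_step {G : E d → E d} {κ : ℝ} (hκ : 0 ≤ κ) (hG0 : G 0 = 0)
    (hG : ∀ R z w, ‖z‖ ≤ R → ‖w‖ ≤ R → ‖G z - G w - (z - w)‖ ≤ κ * R * ‖z - w‖)
    {z z' : E d} {B : Mat d} (hz : z' = z - mApp B (G z)) (hne : z' - z ≠ 0)
    (hσ : κ * ‖z‖ ≤ 1 / 400) (hB : ‖B - 1‖ ≤ 1 / 10) :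
    ∃ θ, 0 ≤ θ ∧ ‖z'‖ ≤ (13 / 10 * θ + κ * ‖z‖) * ‖z‖ ∧ κ * ‖z'‖ ≤ κ * ‖z‖ / 2 ∧
      ‖bfgsUpdate B (z' - z) (G z' - G z) - 1‖ ^ 2 ≤ ‖B - 1‖ ^ 2 - θ ^ 2 + κ * ‖z‖ := by
  set r := ‖z‖ with hr
  have hr0 : 0 ≤ r := norm_nonneg _
  set s := z' - z with hs
  have hspos : 0 < ‖s‖ := norm_pos_iff.2 hne
  set θ := ‖mApp (B - 1) s‖ / ‖s‖ with hθ
  have hθs : ‖mApp (B - 1) s‖ = θ * ‖s‖ := by rw [hθ, div_mul_cancel₀ _ hspos.ne']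
  have hθ0 : 0 ≤ θ := by positivity
  have hθ1 : θ ≤ 1 / 10 := by
    rw [hθ, div_le_iff₀ hspos]
    exact (norm_mApp_le _ _).trans (by gcongr)
  have hGz : ‖G z - z‖ ≤ κ * r * r := by
    simpa [hG0] using hG r z 0 le_rfl (by simpa using hr0)
  have hGn : ‖G z‖ ≤ 401 / 400 * r := by
    have := norm_le_norm_add_norm_sub' (G z) z
    nlinarith
  have hsB : s = - mApp B (G z) := by rw [hs, hz]; abel
  have hB' : ∀ v, mApp B v = mApp (B - 1) v + v := fun v => by rw [sub_mApp, mApp_one]; abel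
  have hBle : ∀ v, ‖mApp (B - 1) v‖ ≤ 1 / 10 * ‖v‖ := fun v =>
    (norm_mApp_le _ _).trans (by gcongr)
  have hsn : ‖s‖ ≤ 11 / 10 * (401 / 400 * r) := by
    rw [hsB, norm_neg, hB']
    have := norm_add_le (mApp (B - 1) (G z)) (G z)
    linarith [hBle (G z)]
  have hsg : 9 / 10 * ‖s + G z‖ ≤ θ * ‖s‖ := by
    have h1 : mApp (B - 1) s = mApp (B - 1) (s + G z) + (s + G z) := by
      rw [← hB', mApp_add, sub_mApp, mApp_one]
      nth_rewrite 2 [hsB]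
      abel
    have h2 := norm_sub_le (mApp (B - 1) s) (mApp (B - 1) (s + G z))
    rw [h1, add_sub_cancel_left, ← h1, hθs] at h2
    linarith [hBle (s + G z)]
  have hz'n : ‖z'‖ ≤ (13 / 10 * θ + κ * r) * r := by
    have h1 : z' = (s + G z) - (G z - z) := by rw [hs]; abel
    have h2 := norm_sub_le (s + G z) (G z - z)
    rw [← h1] at h2
    nlinarith [mul_le_mul_of_nonneg_left hsn hθ0, mul_nonneg hθ0 hr0]
  have hhalf : ‖z'‖ ≤ r / 2 := by
    refine hz'n.trans ?_
    nlinarith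
  refine ⟨θ, hθ0, hz'n, by nlinarith, ?_⟩
  exact norm_sq_bfgsUpdate_sub_one_le_of_ne_zero B hne
    (hG r z' z (hhalf.trans (by linarith)) le_rfl) hσ hB

/-- If the squared contraction ratios of `r` telescope against a bounded potential, then `r`
converges superlinearly. -/
theorem superlinear_of_potential {r Ψ a : ℕ → ℝ} (hr : ∀ k, 0 ≤ r k) (hΨ : ∀ k, 0 ≤ Ψ k)
    (hΨ0 : Ψ 0 ≤ 1) (ha : ∀ k, 0 ≤ a k) (hra : ∀ k, r (k + 1) ≤ a k * r k)
    (haΨ : ∀ k, a k ^ 2 ≤ Ψ k - Ψ (k + 1)) {k : ℕ} (hk : 1 ≤ k) :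
    r k ≤ (1 / (k : ℝ)) ^ ((k : ℝ) / 2) * r 0 := by
  have hprod : ∀ n, r n ≤ (∏ i ∈ Finset.range n, a i) * r 0 := fun n => by
    induction n with
    | zero => simp
    | succ n ih =>
      rw [Finset.prod_range_succ, mul_comm _ (a n), mul_assoc]
      exact (hra n).trans (mul_le_mul_of_nonneg_left ih (ha n))
  have hsum : ∑ i ∈ Finset.range k, a i ^ 2 ≤ 1 :=
    (Finset.sum_le_sum fun i _ => haΨ i).trans (by
      rw [Finset.sum_range_sub']; linarith [hΨ k])
  have hk0 : (0 : ℝ) < k := by exact_mod_cast hk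
  have hamgm : (∏ i ∈ Finset.range k, a i ^ 2) ^ ((k : ℝ)⁻¹) ≤ 1 / k := by
    have := Real.geom_mean_le_arith_mean (Finset.range k) (fun _ => 1) (fun i => a i ^ 2)
      (by simp) (by simpa using hk0) (fun i _ => sq_nonneg _)
    simp only [Real.rpow_one, Finset.sum_const, Finset.card_range, nsmul_eq_mul, mul_one,
      one_mul] at this
    exact this.trans (by gcongr)
  have hP0 : 0 ≤ ∏ i ∈ Finset.range k, a i := Finset.prod_nonneg fun i _ => ha i
  refine (hprod k).trans (mul_le_mul_of_nonneg_right ?_ (hr 0))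
  rw [Finset.prod_pow] at hamgm
  have h := Real.rpow_le_rpow (by positivity) hamgm (show 0 ≤ (k : ℝ) / 2 by positivity)
  rwa [← Real.rpow_mul (by positivity), ← Real.rpow_natCast, ← Real.rpow_mul hP0,
    show ((2 : ℕ) : ℝ) * ((k : ℝ)⁻¹ * (k / 2)) = 1 by push_cast; field_simp, Real.rpow_one] at h

/-- Superlinear convergence of BFGS in the coordinates where the Hessian at the minimizer is the
identity. -/
theorem bfgs_superlinear_normalized {G : E d → E d} {κ : ℝ} (hκ : 0 ≤ κ) (hG0 : G 0 = 0)
    (hG : ∀ R z w, ‖z‖ ≤ R → ‖w‖ ≤ R → ‖G z - G w - (z - w)‖ ≤ κ * R * ‖z - w‖)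
    {z : ℕ → E d} {B : ℕ → Mat d} (hz : ∀ k, z (k + 1) = z k - mApp (B k) (G (z k)))
    (hne : ∀ k, z (k + 1) - z k ≠ 0)
    (hBup : ∀ k, B (k + 1) = bfgsUpdate (B k) (z (k + 1) - z k) (G (z (k + 1)) - G (z k)))
    (hσ : κ * ‖z 0‖ ≤ 1 / 400) (hB : ‖B 0 - 1‖ ≤ 1 / 24) {k : ℕ} (hk : 1 ≤ k) :
    ‖z k‖ ≤ (1 / (k : ℝ)) ^ ((k : ℝ) / 2) * ‖z 0‖ := by
  set Ψ : ℕ → ℝ := fun k => 4 * ‖B k - 1‖ ^ 2 + 10 * (κ * ‖z k‖) with hΨ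
  have hle : ∀ {n}, Ψ n ≤ 4 / 100 → ‖B n - 1‖ ≤ 1 / 10 := fun {n} h => by
    have h0 : 0 ≤ κ * ‖z n‖ := by positivity
    refine abs_le_of_sq_le_sq' (by simp only [hΨ] at h; nlinarith) (by norm_num) |>.2
  have hstep : ∀ n, κ * ‖z n‖ ≤ 1 / 400 → Ψ n ≤ 4 / 100 →
      ∃ a, 0 ≤ a ∧ ‖z (n + 1)‖ ≤ a * ‖z n‖ ∧ κ * ‖z (n + 1)‖ ≤ κ * ‖z n‖ / 2 ∧
        a ^ 2 ≤ Ψ n - Ψ (n + 1) := fun n h1 h2 => by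
    have h0 : 0 ≤ κ * ‖z n‖ := by positivity
    obtain ⟨θ, hθ, hr, hr', hB'⟩ := bfgs_step hκ hG0 hG (hz n) (hne n) h1 (hle h2)
    rw [← hBup n] at hB'
    refine ⟨_, by positivity, hr, hr', ?_⟩
    simp only [hΨ]
    nlinarith [sq_nonneg (13 / 10 * θ - κ * ‖z n‖)]
  have hinv : ∀ n, κ * ‖z n‖ ≤ 1 / 400 ∧ Ψ n ≤ 4 / 100 := fun n => by
    induction n with
    | zero =>
      refine ⟨hσ, ?_⟩
      simp only [hΨ]
      nlinarith [norm_nonneg (B 0 - 1)]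
    | succ n ih =>
      obtain ⟨a, -, -, h1, h2⟩ := hstep n ih.1 ih.2
      have h0 : 0 ≤ κ * ‖z n‖ := by positivity
      exact ⟨by linarith [ih.1], by nlinarith [ih.2]⟩
  choose a ha0 har _ haΨ using fun n => hstep n (hinv n).1 (hinv n).2
  exact superlinear_of_potential (r := fun n => ‖z n‖) (fun n => norm_nonneg _)
    (fun n => by positivity) ((hinv 0).2.trans (by norm_num)) ha0 har haΨ hk

end FrobeniusNorm

section

variable {d : ℕ}

theorem dot_mApp_mApp_of_symm {S T : Mat d} (hT : Tᵀ = T) (hTS : T * S = 1) (u v : E d) :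
    dot (mApp S u) (mApp T v) = dot u v := by
  rw [dot_mApp, hT, ← mApp_mul, hTS, mApp_one]

/-- The BFGS update is covariant under linear changes of variables. -/
theorem conj_bfgsUpdate {S T : Mat d} (hS : Sᵀ = S) (hT : Tᵀ = T) (hTS : T * S = 1)
    (H : Mat d) (s y : E d) :
    S * bfgsUpdate H s y * S = bfgsUpdate (S * H * S) (mApp S s) (mApp T y) := by
  have hST : S * T = 1 := mul_eq_one_comm.1 hTS
  have h1 : dot (mApp S s) (mApp T y) = dot s y := dot_mApp_mApp_of_symm hT hTS s y
  have h2 : dot (mApp T y) (mApp S s) = dot y s := dot_mApp_mApp_of_symm hS hST y s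
  rw [bfgsUpdate, bfgsUpdate, h1, h2, outer_mApp, outer_mApp, outer_mApp, hS, hT]
  set a := (dot y s)⁻¹
  set b := (dot s y)⁻¹
  have e1 : S * (1 - a • outer s y) = (1 - a • (S * outer s y * T)) * S := by
    rw [mul_sub, sub_mul, smul_mul_assoc, mul_assoc _ T S, hTS]; simp
  have e2 : (1 - b • outer y s) * S = S * (1 - b • (T * outer y s * S)) := by
    rw [mul_sub, sub_mul, mul_smul_comm, mul_assoc T, ← mul_assoc S T, hST]; simp
  calc S * ((1 - a • outer s y) * H * (1 - b • outer y s) + a • outer s s) * S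
      = (S * (1 - a • outer s y)) * H * ((1 - b • outer y s) * S)
          + a • (S * outer s s * S) := by
        simp only [mul_add, add_mul, mul_assoc, mul_smul_comm, smul_mul_assoc]
    _ = _ := by rw [e1, e2]; simp only [mul_assoc]

theorem norm_mApp_sq_of_symm {S K : Mat d} (hS : Sᵀ = S) (hSK : S * S = K) (v : E d) :
    ‖mApp S v‖ ^ 2 = dot v (mApp K v) := by
  rw [← hSK, mApp_mul, dot_mApp S v, hS, dot_self]

theorem gradient_eq_zero_of_forall_le {f : E d → ℝ} {x g : E d} (hg : HasGradientAt f g x)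
    (hmin : ∀ y, f x ≤ f y) : g = 0 := by
  have h : IsLocalMin f x := Filter.Eventually.of_forall hmin
  simpa using h.hasFDerivAt_eq_zero hg.hasFDerivAt

/-- Deviation from linearity of the gradient, in coordinates normalized by `S`, the square root
of the Hessian at `xs`. -/
theorem norm_normalized_gradient_sub_le {g : E d → E d} {Hess : E d → Mat d} {xs : E d}
    {M m : ℝ} (hm : 0 < m) (hM : 0 ≤ M)
    (hHd : ∀ x, HasFDerivAt g (Matrix.toEuclideanCLM (𝕜 := ℝ) (Hess x)) x)
    (hLip : ∀ x, spec (Hess x - Hess xs) ≤ M * ‖x - xs‖)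
    {S T : Mat d} (hTS : T * S = 1) (hSS : S * S = Hess xs)
    (hTm : ∀ v, ‖mApp T v‖ ≤ ‖v‖ / m) {R : ℝ} {z w : E d} (hz : ‖z‖ ≤ R) (hw : ‖w‖ ≤ R) :
    ‖mApp T (g (xs + mApp T z)) - mApp T (g (xs + mApp T w)) - (z - w)‖
      ≤ M / m ^ 3 * R * ‖z - w‖ := by
  have hmem : ∀ v : E d, ‖v‖ ≤ R → xs + mApp T v ∈ Metric.closedBall xs (R / m) := fun v hv => by
    rw [mem_closedBall_iff_norm, add_sub_cancel_left]
    exact (hTm v).trans (by gcongr)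
  have hmv := (convex_closedBall xs (R / m)).norm_image_sub_le_of_norm_hasFDerivWithin_le'
    (φ := Matrix.toEuclideanCLM (𝕜 := ℝ) (Hess xs)) (C := M * (R / m))
    (fun x _ => (hHd x).hasFDerivWithinAt)
    (fun x hx => by
      rw [← map_sub]
      exact (hLip x).trans (by
        gcongr
        exact mem_closedBall_iff_norm.1 hx)) (hmem w hw) (hmem z hz)
  rw [add_sub_add_left_eq_sub, ← mApp_sub] at hmv
  have hST : S * T = 1 := mul_eq_one_comm.1 hTS
  have hTHT : mApp T (mApp (Hess xs) (mApp T (z - w))) = z - w := by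
    rw [← mApp_mul, ← mApp_mul, ← hSS, ← mul_assoc T S S, hTS, one_mul, hST, mApp_one]
  have hR : 0 ≤ R := (norm_nonneg z).trans hz
  calc ‖mApp T (g (xs + mApp T z)) - mApp T (g (xs + mApp T w)) - (z - w)‖
      = ‖mApp T (g (xs + mApp T z) - g (xs + mApp T w)
          - mApp (Hess xs) (mApp T (z - w)))‖ := by rw [mApp_sub, mApp_sub, hTHT]
    _ ≤ (M * (R / m) * (‖z - w‖ / m)) / m := (hTm _).trans (by
        gcongr
        exact hmv.trans (by gcongr; exact hTm _))
    _ = M / m ^ 3 * R * ‖z - w‖ := by field_simp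

end

theorem bfgs_superlinear_convergence_explicit
    {d : ℕ}
    (f : E d → ℝ) (g : E d → E d) (Hess : E d → Mat d) (xs : E d)
    (μ L M : ℝ) (hμ : 0 < μ) (hμL : μ ≤ L) (hM : 0 < M)
    -- `g` is the gradient of `f`, and `Hess` its Hessian (so `f` is twice differentiable)
    (hg : ∀ x, HasGradientAt f (g x) x)
    (hHd : ∀ x, HasFDerivAt g (Matrix.toEuclideanCLM (𝕜 := ℝ) (Hess x)) x)
    -- `xs` is the unique minimizer of `f`
    (hmin : ∀ x, f xs ≤ f x)
    (huniq : ∀ x, (∀ y, f x ≤ f y) → x = xs)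
    -- Assumption 1: strong convexity and gradient Lipschitz continuity
    (hgl : ∀ x y, μ * ‖x - y‖ ≤ ‖g x - g y‖)
    (hgu : ∀ x y, ‖g x - g y‖ ≤ L * ‖x - y‖)
    (hHl : ∀ x v, μ * ‖v‖ ^ 2 ≤ dot v (mApp (Hess x) v))
    (hHu : ∀ x v, dot v (mApp (Hess x) v) ≤ L * ‖v‖ ^ 2)
    -- Assumption 2: Hessian Lipschitz continuity toward the optimum
    (hLip : ∀ x, spec (Hess x - Hess xs) ≤ M * ‖x - xs‖)
    -- `sqH` is the positive definite square root `H_*^{1/2}` of `H_* = ∇²f(x_*)`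
    (sqH : Mat d) (hsqH : sqH.PosDef) (hsqH2 : sqH * sqH = Hess xs)
    -- the BFGS method
    (x : ℕ → E d) (H : ℕ → Mat d)
    (hH0pd : (H 0).PosDef)
    (hxup : ∀ k, x (k+1) = x k - mApp (H k) (g (x k)))
    (hsne : ∀ k, x (k+1) - x k ≠ 0)
    (hHup : ∀ k, H (k+1) = bfgsUpdate (H k) (x (k+1) - x k) (g (x (k+1)) - g (x k)))
    (hx0 : ‖x 0 - xs‖ ≤ μ ^ ((3:ℝ)/2) / (400 * M * Real.sqrt L))
    (hH0 : frob (sqH * H 0 * sqH - 1) ≤ 1/24) :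
    ∀ k : ℕ, 1 ≤ k →
      ‖x k - xs‖ ≤ Real.sqrt (L / μ) * (1/(k:ℝ)) ^ ((k:ℝ)/2) * ‖x 0 - xs‖ := by
  intro k hk
  have hL : 0 < L := hμ.trans_le hμL
  set m := Real.sqrt μ with hm_def
  have hm : 0 < m := Real.sqrt_pos.2 hμ
  have hm3 : μ ^ ((3 : ℝ) / 2) = m ^ 3 := by
    rw [hm_def, Real.sqrt_eq_rpow, ← Real.rpow_natCast, ← Real.rpow_mul hμ.le]; norm_num
  have hS : sqHᵀ = sqH := by
    rw [← Matrix.conjTranspose_eq_transpose_of_trivial]; exact hsqH.isHermitian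
  set T := sqH⁻¹ with hT_def
  have hdet : IsUnit sqH.det := (Matrix.isUnit_iff_isUnit_det _).1 hsqH.isUnit
  have hT : Tᵀ = T := by rw [hT_def, Matrix.transpose_nonsing_inv, hS]
  have hTS : T * sqH = 1 := Matrix.nonsing_inv_mul _ hdet
  have hST : sqH * T = 1 := Matrix.mul_nonsing_inv _ hdet
  have hSl : ∀ v, m * ‖v‖ ≤ ‖mApp sqH v‖ := fun v => by
    refine le_of_sq_le_sq ?_ (norm_nonneg _)
    rw [mul_pow, Real.sq_sqrt hμ.le, norm_mApp_sq_of_symm hS hsqH2]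
    exact hHl xs v
  have hSu : ∀ v, ‖mApp sqH v‖ ≤ Real.sqrt L * ‖v‖ := fun v => by
    refine le_of_sq_le_sq ?_ (by positivity)
    rw [mul_pow, Real.sq_sqrt hL.le, norm_mApp_sq_of_symm hS hsqH2]
    exact hHu xs v
  have hTm : ∀ v, ‖mApp T v‖ ≤ ‖v‖ / m := fun v => by
    rw [le_div_iff₀ hm, mul_comm]
    simpa [← mApp_mul, hST, mApp_one] using hSl (mApp T v)
  have hback : ∀ n, xs + mApp T (mApp sqH (x n - xs)) = x n := fun n => by
    rw [← mApp_mul, hTS, mApp_one]; abel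
  have hdiff : ∀ n, mApp sqH (x (n + 1) - xs) - mApp sqH (x n - xs)
      = mApp sqH (x (n + 1) - x n) := fun n => by
    rw [← mApp_sub]; congr 1; abel
  have hz0 : ‖mApp sqH (x 0 - xs)‖ ≤ Real.sqrt L * ‖x 0 - xs‖ := hSu _
  have hmain := bfgs_superlinear_normalized (κ := M / m ^ 3)
    (G := fun z => mApp T (g (xs + mApp T z))) (z := fun n => mApp sqH (x n - xs))
    (B := fun n => sqH * H n * sqH) (by positivity)
    (by
      have h0 : mApp T (0 : E d) = 0 := by simp [mApp]
      simp only [h0, add_zero, gradient_eq_zero_of_forall_le (hg xs) hmin])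
    (fun R z w hz hw => norm_normalized_gradient_sub_le hm hM.le hHd hLip hTS hsqH2 hTm hz hw)
    (fun n => by
      simp only [hback]
      rw [← mApp_mul, mul_assoc _ sqH T, hST, mul_one, mApp_mul, ← mApp_sub, hxup n]
      congr 1; abel)
    (fun n h => hsne n (by
      simp only [hdiff] at h
      have := hSl (x (n + 1) - x n)
      rw [h, norm_zero] at this
      exact norm_le_zero_iff.1 (by nlinarith)))
    (fun n => by
      simp only [hback, hdiff]
      rw [← mApp_sub, hHup n, conj_bfgsUpdate hS hT hTS])
    (by
      rw [hm3] at hx0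
      have hL' : 0 < Real.sqrt L := Real.sqrt_pos.2 hL
      calc M / m ^ 3 * ‖mApp sqH (x 0 - xs)‖
          ≤ M / m ^ 3 * (Real.sqrt L * (m ^ 3 / (400 * M * Real.sqrt L))) := by
            gcongr; exact hz0.trans (by gcongr)
        _ = 1 / 400 := by field_simp)
    (by rwa [← frob_eq_norm]) hk
  have hk' := (hSl (x k - xs)).trans (hmain.trans
    (mul_le_mul_of_nonneg_left hz0 (by positivity)))
  rw [← le_div_iff₀' hm] at hk'
  refine hk'.trans (le_of_eq ?_)
  rw [Real.sqrt_div hL.le]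
  ring
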